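/- f(6, 20) = 49. That is, the minimum size of a multiset of affine hyperplanes in ℝ^6, none passing through the origin, covering every nonzero point of {0,1}^6 at least 20 times (with multiplicity), is exactly 49. -/

import Mathlib

open scoped Classical in
/-- `coverNumber n k` is the minimum size of a multiset `C` of coefficient vectors
`c ∈ ℝ^n` (each representing the hyperplane `{x : ∑ i, c i * x i = 1}`, which avoids
the origin) such that every nonzero point `x ∈ {0,1}^n` lies on at least `k` of the
hyperplanes, counted with multiplicity. -/
noncomputable def coverNumber (n k : ℕ) : ℕ :=
  sInf {m | ∃ C : Multiset (Fin n → ℝ),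
    Multiset.card C = m ∧
    ∀ x : Fin n → ℝ, (∀ i, x i = 0 ∨ x i = 1) → x ≠ 0 →
      k ≤ Multiset.card (C.filter (fun c => ∑ i, c i * x i = 1))}

/-- The `n`-th harmonic number, as a real number. -/
noncomputable def harmonicR (n : ℕ) : ℝ := ∑ i ∈ Finset.range n, 1 / ((i : ℝ) + 1)

open Finset

/-- The sum of the coefficients `c` over the first `s + 1` coordinates in the order `σ`. -/
def prefixSum {n : ℕ} (c : Fin n → ℝ) (σ : Equiv.Perm (Fin n)) (s : Fin n) : ℝ :=
  ∑ i ∈ Iic s, c (σ i)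

/-- **Cycle lemma**: if consecutive increments of `P` over a period `m` add up to a positive
number `w`, then some cyclic shift has all its proper partial sums less than `w`. -/
theorem exists_shift_lt_of_add_period (P : ℕ → ℝ) {m : ℕ} {w : ℝ} (hm : 0 < m) (hw : 0 < w)
    (hP : ∀ j, P (j + m) = P j + w) :
    ∃ r < m, ∀ j, 0 < j → j < m → P (r + j) < P r + w := by
  classical
  have hex : ∃ r, r < m ∧ ∀ j < m, P j ≤ P r := by
    obtain ⟨r, hr, hmax⟩ := exists_max_image (range m) P ⟨0, mem_range.2 hm⟩
    exact ⟨r, mem_range.1 hr, fun j hj => hmax j (mem_range.2 hj)⟩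
  obtain ⟨hr, hmax⟩ := Nat.find_spec hex
  refine ⟨Nat.find hex, hr, fun j hj hjm => ?_⟩
  rcases lt_or_ge (Nat.find hex + j) m with h | h
  · linarith [hmax _ h]
  · obtain ⟨i, hi⟩ := Nat.exists_eq_add_of_le' h
    rw [hi, hP]
    have him : i < Nat.find hex := by omega
    have hlt : P i < P (Nat.find hex) := by
      by_contra! hle
      exact Nat.find_min hex him ⟨by omega, fun l hl => (hmax l hl).trans hle⟩
    linarith

theorem cycleRange_pow_zero {n : ℕ} [NeZero n] (s : Fin n) (j : ℕ) (hj : j ≤ s) :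
    ((s.cycleRange ^ j) 0 : Fin n) = ⟨j, hj.trans_lt s.2⟩ := by
  induction j with
  | zero => rfl
  | succ j ih =>
    rw [pow_succ', Equiv.Perm.mul_apply, ih (by omega)]
    apply Fin.ext
    rw [Fin.coe_cycleRange_of_lt (Fin.lt_def.2 (by simpa using hj))]

theorem cycleRange_pow_period {n : ℕ} [NeZero n] (s : Fin n) :
    ((s.cycleRange ^ ((s : ℕ) + 1)) 0 : Fin n) = 0 := by
  rw [pow_succ', Equiv.Perm.mul_apply, cycleRange_pow_zero s s le_rfl]
  exact Fin.cycleRange_self s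

theorem prefixSum_mul_cycleRange_pow {n : ℕ} [NeZero n] (c : Fin n → ℝ)
    (σ : Equiv.Perm (Fin n)) {s t : Fin n} (hts : t ≤ s) (r : ℕ) :
    prefixSum c (σ * s.cycleRange ^ r) t =
      ∑ j ∈ range ((t : ℕ) + 1), c (σ ((s.cycleRange ^ (r + j)) 0)) := by
  refine sum_nbij (fun i => (i : ℕ)) ?_ ?_ ?_ ?_
  · intro i hi
    simpa [Nat.lt_succ_iff] using hi
  · intro i _ j _ h
    exact Fin.ext h
  · intro j hj
    have hj' : j ≤ t := by simpa [Nat.lt_succ_iff] using hj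
    exact ⟨⟨j, hj'.trans_lt t.2⟩, by simpa [Fin.le_def] using hj', rfl⟩
  · intro i hi
    have his : (i : ℕ) ≤ s := (mem_Iic.1 hi).trans hts
    rw [pow_add, Equiv.Perm.mul_apply, Equiv.Perm.mul_apply, cycleRange_pow_zero s i his]

theorem exists_cycleRange_pow_prefixSum_lt {n : ℕ} (c : Fin n → ℝ) (σ : Equiv.Perm (Fin n))
    (s : Fin n) (h : prefixSum c σ s = 1) :
    ∃ r < (s : ℕ) + 1, prefixSum c (σ * s.cycleRange ^ r) s = 1 ∧
      ∀ t < s, prefixSum c (σ * s.cycleRange ^ r) t < 1 := by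
  have : NeZero n := ⟨by have := s.2; omega⟩
  set a : ℕ → ℝ := fun j => c (σ ((s.cycleRange ^ j) 0)) with ha
  set P : ℕ → ℝ := fun r => ∑ j ∈ range r, a j with hPdef
  have key : ∀ r, ∀ t ≤ s, prefixSum c (σ * s.cycleRange ^ r) t = P (r + (t + 1)) - P r := by
    intro r t ht
    rw [prefixSum_mul_cycleRange_pow c σ ht r]
    simp only [hPdef, sum_range_add_sub_sum_range, ha]
  have hper : ∀ j, a (j + (s + 1)) = a j := by
    intro j
    simp only [ha, pow_add _ j, Equiv.Perm.mul_apply, cycleRange_pow_period]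
  have hP : ∀ j, P (j + (s + 1)) = P j + 1 := by
    intro j
    induction j with
    | zero =>
      have := key 0 s le_rfl
      simp only [pow_zero, mul_one, h] at this
      linarith
    | succ j ih =>
      have h1 : P (j + 1 + (s + 1)) = P (j + (s + 1)) + a (j + (s + 1)) := by
        rw [show j + 1 + ((s : ℕ) + 1) = j + (s + 1) + 1 by ring]
        exact sum_range_succ _ _
      have h2 : P (j + 1) = P j + a j := sum_range_succ _ _
      rw [h1, h2, ih, hper]
      ring
  obtain ⟨r, hr, hlt⟩ := exists_shift_lt_of_add_period P (Nat.succ_pos s) one_pos hP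
  refine ⟨r, hr, ?_, fun t ht => ?_⟩
  · rw [key r s le_rfl, hP]
    ring
  · rw [key r t ht.le]
    have := hlt (t + 1) (Nat.succ_pos _) (Nat.succ_lt_succ ht)
    linarith

open scoped Classical in
theorem card_prefixSum_eq_one_le {n : ℕ} (c : Fin n → ℝ) (s : Fin n) :
    #{σ : Equiv.Perm (Fin n) | prefixSum c σ s = 1} ≤
      ((s : ℕ) + 1) * #{σ : Equiv.Perm (Fin n) | prefixSum c σ s = 1 ∧
        ∀ t < s, prefixSum c σ t < 1} := by
  set A : Finset (Equiv.Perm (Fin n)) :=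
    {σ | prefixSum c σ s = 1 ∧ ∀ t < s, prefixSum c σ t < 1} with hA
  have hsub : ({σ | prefixSum c σ s = 1} : Finset (Equiv.Perm (Fin n))) ⊆
      (range ((s : ℕ) + 1)).biUnion fun r => A.image fun τ => τ * (s.cycleRange ^ r)⁻¹ := by
    intro σ hσ
    obtain ⟨r, hr, h⟩ := exists_cycleRange_pow_prefixSum_lt c σ s (by simpa using hσ)
    refine mem_biUnion.2 ⟨r, mem_range.2 hr, mem_image.2 ⟨_, ?_, mul_inv_cancel_right σ _⟩⟩
    simpa [hA] using h
  calc _ ≤ _ := card_le_card hsub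
    _ ≤ #(range ((s : ℕ) + 1)) * #A := card_biUnion_le_card_mul _ _ _ fun r _ => card_image_le
    _ = _ := by rw [card_range]

open scoped Classical in
/-- The weighted number of prefixes of orderings that lie on the hyperplane of `c` is at most the
number of orderings. -/
theorem sum_inv_mul_card_prefixSum_eq_one_le {n : ℕ} (c : Fin n → ℝ) :
    ∑ s : Fin n, 1 / ((s : ℝ) + 1) * (#{σ : Equiv.Perm (Fin n) | prefixSum c σ s = 1} : ℝ) ≤
      (Fintype.card (Equiv.Perm (Fin n)) : ℝ) := by
  set A : Fin n → Finset (Equiv.Perm (Fin n)) := fun s =>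
    {σ | prefixSum c σ s = 1 ∧ ∀ t < s, prefixSum c σ t < 1} with hA
  have hdisj : Set.PairwiseDisjoint (univ : Finset (Fin n)) A := by
    intro s _ t _ hst
    refine disjoint_left.2 fun σ hs ht => ?_
    simp only [hA, mem_filter, mem_univ, true_and] at hs ht
    rcases lt_or_gt_of_ne hst with h | h
    · exact (ht.2 s h).ne hs.1
    · exact (hs.2 t h).ne ht.1
  calc _ ≤ ∑ s, (#(A s) : ℝ) := by
        refine sum_le_sum fun s _ => ?_
        rw [one_div, inv_mul_le_iff₀ (by positivity)]
        exact_mod_cast card_prefixSum_eq_one_le c s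
    _ = (#(univ.biUnion A) : ℝ) := by rw [card_biUnion hdisj]; push_cast; rfl
    _ ≤ _ := by exact_mod_cast card_le_univ _

open scoped Classical in
/-- Every almost `k`-cover of the `n`-cube has at least `k * (1 + 1 / 2 + ⋯ + 1 / n)` members. -/
theorem mul_harmonicR_le_card {n k : ℕ} (C : Multiset (Fin n → ℝ))
    (hC : ∀ x : Fin n → ℝ, (∀ i, x i = 0 ∨ x i = 1) → x ≠ 0 →
      k ≤ Multiset.card (C.filter (fun c => ∑ i, c i * x i = 1))) :
    k * harmonicR n ≤ Multiset.card C := by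
  set N : ℝ := (Fintype.card (Equiv.Perm (Fin n)) : ℝ) with hN
  have hNpos : 0 < N := Nat.cast_pos.2 Fintype.card_pos
  have hcover : ∀ (σ : Equiv.Perm (Fin n)) (s : Fin n),
      k ≤ Multiset.card (C.filter fun c => prefixSum c σ s = 1) := by
    intro σ s
    have hsum : ∀ c : Fin n → ℝ,
        ∑ i, c i * (if σ.symm i ≤ s then (1 : ℝ) else 0) = prefixSum c σ s := by
      intro c
      rw [← Equiv.sum_comp σ]
      simp [prefixSum, ← sum_filter, filter_ge_eq_Iic]
    simp only [← hsum]
    refine hC _ (fun i => ?_) fun h => ?_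
    · by_cases hi : σ.symm i ≤ s <;> simp [hi]
    · simpa using congrFun h (σ s)
  have hupper : ∑ s : Fin n, 1 / ((s : ℝ) + 1) * ∑ σ : Equiv.Perm (Fin n),
      (Multiset.card (C.filter fun c => prefixSum c σ s = 1) : ℝ) ≤ Multiset.card C * N := by
    clear hcover hC
    induction C using Multiset.induction with
    | empty => simp
    | cons c C ih =>
      have h := sum_inv_mul_card_prefixSum_eq_one_le c
      have hsplit : ∀ s (σ : Equiv.Perm (Fin n)),
          (Multiset.card ((c ::ₘ C).filter fun c => prefixSum c σ s = 1) : ℝ) =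
          (if prefixSum c σ s = 1 then 1 else 0) +
            (Multiset.card (C.filter fun c => prefixSum c σ s = 1) : ℝ) := by
        intro s σ
        rw [Multiset.filter_cons]
        split_ifs <;> simp [add_comm]
      simp only [hsplit, sum_add_distrib, sum_boole, mul_add, Multiset.card_cons, Nat.cast_add,
        Nat.cast_one, add_mul, one_mul]
      linarith
  have hlower : k * harmonicR n * N ≤ ∑ s : Fin n, 1 / ((s : ℝ) + 1) *
      ∑ σ : Equiv.Perm (Fin n),
        (Multiset.card (C.filter fun c => prefixSum c σ s = 1) : ℝ) := by
    calc k * harmonicR n * N =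
          ∑ s : Fin n, 1 / ((s : ℝ) + 1) * ∑ _σ : Equiv.Perm (Fin n), (k : ℝ) := by
          rw [harmonicR, ← Fin.sum_univ_eq_sum_range (fun i => 1 / ((i : ℝ) + 1)), ← sum_mul]
          simp only [sum_const, card_univ, nsmul_eq_mul, ← hN]
          ring
      _ ≤ _ := by
          gcongr with s _ σ _
          exact hcover σ s
  exact le_of_mul_le_mul_right (hlower.trans hupper) hNpos

/-- The vectors obtained by rotating the first five of six coordinates. -/
def rotations (c : Fin 6 → ℤ) : List (Fin 6 → ℤ) :=
  [![c 0, c 1, c 2, c 3, c 4, c 5], ![c 1, c 2, c 3, c 4, c 0, c 5],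
    ![c 2, c 3, c 4, c 0, c 1, c 5], ![c 3, c 4, c 0, c 1, c 2, c 5],
    ![c 4, c 0, c 1, c 2, c 3, c 5]]

/-- The coefficient vectors of an almost `20`-cover of the `6`-cube by `49` hyperplanes. -/
def coverSixTwenty : List (Fin 6 → ℤ) :=
  [![1, 1, 1, 1, 1, 0], ![1, 1, 1, 1, 1, 0], ![1, 1, 1, 1, 1, -3], ![1, 1, 1, 1, 1, -3]] ++
  [![1, 1, 0, 0, 0, 0], ![1, 1, 0, 0, -1, 1], ![1, 1, 0, 0, -1, 0], ![1, 1, 0, -2, 0, 1],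
    ![1, 0, 1, 0, 0, 0], ![1, 0, 1, 0, 0, 0], ![1, 0, 1, -1, -1, 1], ![1, 0, 0, 0, 0, 1],
    ![1, 0, 0, 0, 0, 0]].flatMap rotations

theorem twenty_le_countP_coverSixTwenty :
    ∀ b : Fin 6 → Fin 2, b ≠ 0 →
      20 ≤ coverSixTwenty.countP fun c => ∑ i, c i * ((b i : ℕ) : ℤ) = 1 := by
  decide +kernel

open scoped Classical in
theorem exists_almost_twenty_cover :
    ∃ C : Multiset (Fin 6 → ℝ), Multiset.card C = 49 ∧
      ∀ x : Fin 6 → ℝ, (∀ i, x i = 0 ∨ x i = 1) → x ≠ 0 →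
        20 ≤ Multiset.card (C.filter (fun c => ∑ i, c i * x i = 1)) := by
  refine ⟨(coverSixTwenty : Multiset (Fin 6 → ℤ)).map fun c i => (c i : ℝ), rfl,
    fun x hx hx0 => ?_⟩
  have hex : ∀ i, ∃ b : Fin 2, x i = (((b : ℕ) : ℤ) : ℝ) := by
    intro i
    rcases hx i with h | h
    · exact ⟨0, by simp [h]⟩
    · exact ⟨1, by simp [h]⟩
  choose b hb using hex
  have hb0 : b ≠ 0 := by
    rintro rfl
    exact hx0 (funext fun i => by simp [hb])
  have hiff : ∀ c : Fin 6 → ℤ,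
      ∑ i, (c i : ℝ) * x i = 1 ↔ ∑ i, c i * ((b i : ℕ) : ℤ) = 1 := by
    intro c
    simp only [hb]
    exact_mod_cast Iff.rfl
  rw [← Multiset.countP_eq_card_filter, Multiset.countP_map]
  simp only [hiff]
  rw [← Multiset.countP_eq_card_filter, Multiset.coe_countP]
  convert twenty_le_countP_coverSixTwenty b hb0

theorem f_six_twenty : coverNumber 6 20 = 49 := by
  refine le_antisymm (Nat.sInf_le exists_almost_twenty_cover) ?_
  refine le_csInf ⟨49, exists_almost_twenty_cover⟩ ?_
  rintro m ⟨C, rfl, hC⟩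
  have h := mul_harmonicR_le_card C hC
  have hH : harmonicR 6 = 49 / 20 := by
    norm_num [harmonicR, sum_range_succ]
  rw [hH] at h
  norm_num at h
  exact_mod_cast h
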